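/- arXiv:1802.08500 — 2 statements merged into one kernel-verified Lean document; each statement's English description precedes it below -/
import Mathlib

section
/- Let L be a countable first-order language and M a countably infinite L-structure whose complete theory is ℵ₀-categorical. Then for every natural number n, every orbit of the coordinatewise action of the automorphism group of M on (Fin n → M) is a definable subset of (Fin n → M) without parameters, i.e., it is the solution set in M of some first-order L-formula with n free variables. -/
open FirstOrder Cardinal

namespace RN
open FirstOrder.Language

variable {L : FirstOrder.Language} {M : Type*} [L.Structure M]

/-- Two tuples have the same type. -/
def SameType (L : FirstOrder.Language) {M : Type*} [L.Structure M] {α : Type} (a b : α → M) : Prop :=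
  ∀ φ : L.Formula α, φ.Realize a ↔ φ.Realize b

theorem SameType.comp {α β : Type} {a b : α → M} (h : SameType L a b) (f : β → α) :
    SameType L (a ∘ f) (b ∘ f) := fun φ => by
  have := h (φ.relabel f)
  simpa [Formula.realize_relabel] using this

theorem SameType.symm {α : Type} {a b : α → M} (h : SameType L a b) : SameType L b a :=
  fun φ => (h φ).symm

/-- One extension step. -/
theorem extend (hiso : ∀ (n : ℕ) (a : Fin n → M),
      (∅ : Set M).Definable L {b : Fin n → M | SameType L a b})
    {k : ℕ} {a b : Fin k → M} (h : SameType L a b) (c : M) :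
    ∃ d : M, SameType L (Fin.snoc a c : Fin (k+1) → M) (Fin.snoc b d : Fin (k+1) → M) := by
  have h1 := (hiso (k+1) (Fin.snoc a c)).image_comp (Fin.castSucc : Fin k → Fin (k+1))
  obtain ⟨φ, hφ⟩ := Set.empty_definable_iff.1 h1
  have ha : a ∈ Set.ofPred φ.Realize := by
    rw [← hφ]
    refine ⟨Fin.snoc a c, fun φ => Iff.rfl, ?_⟩
    ext i; simp
  have hb : b ∈ Set.ofPred φ.Realize := (h φ).1 ha
  rw [← hφ] at hb
  obtain ⟨g, hg, rfl⟩ := hb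
  refine ⟨g (Fin.last k), ?_⟩
  have e : (Fin.snoc ((fun g : Fin (k+1) → M => g ∘ Fin.castSucc) g) (g (Fin.last k)) :
      Fin (k+1) → M) = g := by
    ext i
    refine Fin.lastCases ?_ (fun j => ?_) i <;> simp
  rw [e]
  exact hg

/-- Finite sets of pairs that are elementary. -/
def Good (L : FirstOrder.Language) {M : Type*} [L.Structure M] (s : Finset (M × M)) : Prop :=
  ∀ (n : ℕ) (v : Fin n → M × M), (∀ i, v i ∈ s) → SameType L (Prod.fst ∘ v) (Prod.snd ∘ v)

theorem good_of_tuple [DecidableEq (M × M)] {n : ℕ} {v : Fin n → M × M}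
    (h : SameType L (Prod.fst ∘ v) (Prod.snd ∘ v)) : Good L (Finset.univ.image v) := by
  intro m w hw
  have : ∀ i, ∃ j, v j = w i := fun i => by simpa using hw i
  choose f hf using this
  have := h.comp f
  have e : w = v ∘ f := by ext1 i; simp [hf]
  rw [e]; exact this

theorem good_forth [DecidableEq (M × M)] (hiso : ∀ (n : ℕ) (a : Fin n → M),
      (∅ : Set M).Definable L {b : Fin n → M | SameType L a b})
    {s : Finset (M × M)} (h : Good L s) (c : M) :
    ∃ t, s ⊆ t ∧ Good L t ∧ ∃ d, (c, d) ∈ t := by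
  let v : Fin s.card → M × M := fun i => (s.equivFin.symm i : M × M)
  obtain ⟨d, hd⟩ := extend hiso (h _ v (fun i => (s.equivFin.symm i).2)) c
  have e1 : (Fin.snoc (Prod.fst ∘ v) c : Fin (s.card+1) → M)
      = Prod.fst ∘ (Fin.snoc v (c, d) : Fin (s.card+1) → M × M) := by
    ext i; refine Fin.lastCases ?_ (fun j => ?_) i <;> simp
  have e2 : (Fin.snoc (Prod.snd ∘ v) d : Fin (s.card+1) → M)
      = Prod.snd ∘ (Fin.snoc v (c, d) : Fin (s.card+1) → M × M) := by
    ext i; refine Fin.lastCases ?_ (fun j => ?_) i <;> simp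
  rw [e1, e2] at hd
  refine ⟨_, ?_, good_of_tuple hd, d, ?_⟩
  · intro x hx
    simp only [Finset.mem_image, Finset.mem_univ, true_and]
    exact ⟨Fin.castSucc (s.equivFin ⟨x, hx⟩), by simp [v]⟩
  · simp only [Finset.mem_image, Finset.mem_univ, true_and]
    exact ⟨Fin.last _, by simp⟩

theorem Good.swap [DecidableEq (M × M)] {s : Finset (M × M)} (h : Good L s) :
    Good L (s.image Prod.swap) := by
  intro n v hv
  have := (h n (Prod.swap ∘ v) (fun i => by
    obtain ⟨x, hx, hx'⟩ := Finset.mem_image.1 (hv i)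
    simpa [← hx'] using hx)).symm
  exact this

theorem good_back [DecidableEq (M × M)] (hiso : ∀ (n : ℕ) (a : Fin n → M),
      (∅ : Set M).Definable L {b : Fin n → M | SameType L a b})
    {s : Finset (M × M)} (h : Good L s) (d : M) :
    ∃ t, s ⊆ t ∧ Good L t ∧ ∃ c, (c, d) ∈ t := by
  obtain ⟨t, hst, ht, c, hc⟩ := good_forth hiso h.swap d
  refine ⟨t.image Prod.swap, ?_, ht.swap, c, ?_⟩
  · intro x hx
    exact Finset.mem_image.2 ⟨x.swap, hst (Finset.mem_image_of_mem _ hx), by simp⟩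
  · exact Finset.mem_image.2 ⟨_, hc, rfl⟩

theorem back_forth [Countable M] (hiso : ∀ (n : ℕ) (a : Fin n → M),
      (∅ : Set M).Definable L {b : Fin n → M | SameType L a b})
    {n : ℕ} {a b : Fin n → M} (h : SameType L a b) : ∃ π : M ≃[L] M, ⇑π ∘ a = b := by
  classical
  obtain ⟨_⟩ := nonempty_encodable M
  let P := {s : Finset (M × M) // Good L s}
  let D : M ⊕ M → Order.Cofinal P := Sum.elim
    (fun c => ⟨{s | ∃ d, (c, d) ∈ s.1}, fun s => by
      obtain ⟨t, h1, h2, h3⟩ := good_forth hiso s.2 c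
      exact ⟨⟨t, h2⟩, h3, h1⟩⟩)
    (fun d => ⟨{s | ∃ c, (c, d) ∈ s.1}, fun s => by
      obtain ⟨t, h1, h2, h3⟩ := good_back hiso s.2 d
      exact ⟨⟨t, h2⟩, h3, h1⟩⟩)
  let v0 : Fin n → M × M := fun i => (a i, b i)
  let p0 : P := ⟨Finset.univ.image v0, good_of_tuple (v := v0) h⟩
  let I := Order.idealOfCofinals p0 D
  have hfst : ∀ c, ∃ d, ∃ s ∈ I, (c, d) ∈ s.1 := fun c => by
    obtain ⟨s, ⟨d, hd⟩, hs⟩ := Order.cofinal_meets_idealOfCofinals p0 D (Sum.inl c)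
    exact ⟨d, s, hs, hd⟩
  have hsnd : ∀ d, ∃ c, ∃ s ∈ I, (c, d) ∈ s.1 := fun d => by
    obtain ⟨s, ⟨c, hc⟩, hs⟩ := Order.cofinal_meets_idealOfCofinals p0 D (Sum.inr d)
    exact ⟨c, s, hs, hc⟩
  have key : ∀ (m : ℕ) (v : Fin m → M × M), (∀ i, ∃ s ∈ I, v i ∈ s.1) →
      SameType L (Prod.fst ∘ v) (Prod.snd ∘ v) := by
    intro m v hv
    choose s hs hvs using hv
    obtain ⟨t, ht⟩ : ∃ t ∈ I, ∀ i ∈ (Finset.univ : Finset (Fin m)), s i ≤ t := by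
      induction (Finset.univ : Finset (Fin m)) using Finset.induction_on with
      | empty => exact ⟨p0, Order.mem_idealOfCofinals _ _, by simp⟩
      | insert i F _ ih =>
        obtain ⟨t, ht, hF⟩ := ih
        obtain ⟨u, hu, h1, h2⟩ := I.directed _ ht _ (hs i)
        refine ⟨u, hu, fun j hj => ?_⟩
        rcases Finset.mem_insert.1 hj with rfl | hj
        · exact h2
        · exact (hF j hj).trans h1
    exact t.2 m v fun i => ht.2 i (Finset.mem_univ _) (hvs i)
  choose f hf using hfst
  have uniq : ∀ c d c' d', (∃ s ∈ I, (c, d) ∈ s.1) → (∃ s ∈ I, (c', d') ∈ s.1) →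
      (c = c' ↔ d = d') := by
    intro c d c' d' h1 h2
    have := key 2 ![(c, d), (c', d')] (by simp [Fin.forall_fin_two, h1, h2])
      ((Term.var 0).equal (Term.var 1))
    simpa using this
  let F : M ↪ₑ[L] M := ⟨f, fun m φ x =>
    (key m (fun i => (x i, f (x i))) (fun i => hf _) φ).symm⟩
  have hsurj : Function.Surjective f := fun d => by
    obtain ⟨c, hc⟩ := hsnd d
    exact ⟨c, (uniq _ _ _ _ (hf c) hc).1 rfl⟩
  refine ⟨⟨Equiv.ofBijective f ⟨F.injective, hsurj⟩, fun g x => F.map_fun g x,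
    fun r x => F.map_rel r x⟩, ?_⟩
  ext i
  exact (uniq _ _ _ _ (hf (a i)) ⟨p0, Order.mem_idealOfCofinals _ _, by
    simp only [p0, v0, Finset.mem_image, Finset.mem_univ, true_and]
    exact ⟨i, rfl⟩⟩).1 rfl


theorem realize_congr {α : Type} [DecidableEq α] (θ : L.Formula α) {v w : α → M}
    (h : ∀ i ∈ θ.freeVarFinset, v i = w i) : θ.Realize v ↔ θ.Realize w := by
  have h1 := BoundedFormula.realize_restrictFreeVar (φ := θ) (f := id)
    (v := fun i => v i) (xs := (default : Fin 0 → M)) v (fun _ => rfl)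
  have h2 := BoundedFormula.realize_restrictFreeVar (φ := θ) (f := id)
    (v := fun i => v i) (xs := (default : Fin 0 → M)) w (fun i => h i i.2)
  exact h1.symm.trans h2

/-- Projections of formulas in countably many variables are definable. -/
theorem definable_proj [Nonempty M] (θ : L.Formula ℕ) {n : ℕ} (f : Fin n → ℕ) :
    (∅ : Set M).Definable L {b : Fin n → M | ∃ w, θ.Realize w ∧ w ∘ f = b} := by
  classical
  let s : Finset ℕ := θ.freeVarFinset ∪ Finset.univ.image f
  let θ' : L.Formula s := BoundedFormula.restrictFreeVar θ
    (fun i => ⟨i, Finset.mem_union_left _ i.2⟩)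
  have hθ' : ∀ w : ℕ → M, θ'.Realize (fun i => w i) ↔ θ.Realize w := fun w =>
    BoundedFormula.realize_restrictFreeVar w (fun _ => rfl)
  let f' : Fin n → s := fun i => ⟨f i, Finset.mem_union_right _ (by simp)⟩
  have h0 : (∅ : Set M).Definable L {w : s → M | θ'.Realize w} :=
    Set.empty_definable_iff.2 ⟨θ', rfl⟩
  convert h0.image_comp f' using 1
  ext b
  constructor
  · rintro ⟨w, hw, rfl⟩
    exact ⟨fun i => w i, (hθ' w).2 hw, rfl⟩
  · rintro ⟨g, hg, rfl⟩
    let w : ℕ → M := fun i => if h : i ∈ s then g ⟨i, h⟩ else Classical.arbitrary M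
    have e : (fun i : s => w i) = g := by ext i; simp [w]
    refine ⟨w, (hθ' w).1 (by rw [e]; exact hg), ?_⟩
    change (fun i : s => w i) ∘ f' = _
    rw [e]

theorem avoid_density [Nonempty M] {n : ℕ} {a : Fin n → M}
    (ha : ¬ (∅ : Set M).Definable L {b : Fin n → M | SameType L a b})
    (θ : L.Formula ℕ) (hθ : ∃ w : ℕ → M, θ.Realize w) (f : Fin n → ℕ) :
    ∃ φ : L.Formula (Fin n), φ.Realize a ∧ ∃ w : ℕ → M, θ.Realize w ∧ ¬ φ.Realize (w ∘ f) := by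
  by_contra hcon
  push Not at hcon
  have hst : ∀ w : ℕ → M, θ.Realize w → SameType L a (w ∘ f) := fun w hw φ => by
    refine ⟨fun h => hcon φ h w hw, fun h => ?_⟩
    by_contra hna
    exact (Formula.realize_not.1 (hcon φ.not (Formula.realize_not.2 hna) w hw)) h
  apply ha
  have hd := definable_proj (M := M) θ f
  convert hd using 1
  obtain ⟨ψ, hψ⟩ := Set.empty_definable_iff.1 hd
  ext b
  constructor
  · intro hb
    obtain ⟨w, hw⟩ := hθ
    have h1 : w ∘ f ∈ Set.ofPred ψ.Realize := by rw [← hψ]; exact ⟨w, hw, rfl⟩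
    have h2 : ψ.Realize a := (hst w hw ψ).2 h1
    rw [hψ]
    exact (hb ψ).1 h2
  · rintro ⟨w, hw, rfl⟩
    exact hst w hw

theorem henkin_density [Nonempty M] (θ : L.Formula ℕ) (hθ : ∃ w : ℕ → M, θ.Realize w)
    (χ : L.Formula (ℕ ⊕ Fin 1)) :
    ∃ θ' : L.Formula ℕ, (∃ w : ℕ → M, θ'.Realize w) ∧
      (∀ w : ℕ → M, θ'.Realize w → θ.Realize w) ∧
      ∃ i, ∀ w : ℕ → M, θ'.Realize w → ∀ y : M, χ.Realize (Sum.elim w (fun _ => y)) →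
        χ.Realize (Sum.elim w (fun _ => w i)) := by
  classical
  by_cases h : ∃ w : ℕ → M, θ.Realize w ∧ ∃ y : M, χ.Realize (Sum.elim w (fun _ => y))
  · obtain ⟨w, hw, y, hy⟩ := h
    obtain ⟨i, hi⟩ := Infinite.exists_notMem_finset (θ.freeVarFinset ∪ χ.freeVarFinset.toLeft)
    simp only [Finset.mem_union, not_or, Finset.mem_toLeft] at hi
    have hr : ∀ w : ℕ → M, (χ.relabel (Sum.elim id (fun _ => i) : ℕ ⊕ Fin 1 → ℕ)).Realize w ↔
        χ.Realize (Sum.elim w (fun _ => w i)) := fun w => by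
      rw [Formula.realize_relabel]
      have : w ∘ (Sum.elim id (fun _ => i) : ℕ ⊕ Fin 1 → ℕ) = Sum.elim w (fun _ => w i) := by
        ext j; cases j <;> rfl
      rw [this]
    refine ⟨θ ⊓ χ.relabel (Sum.elim id (fun _ => i)), ⟨Function.update w i y, ?_⟩, ?_, i, ?_⟩
    · rw [Formula.realize_inf, hr]
      constructor
      · refine (realize_congr θ fun j hj => ?_).1 hw
        rw [Function.update_of_ne]
        rintro rfl
        exact hi.1 hj
      · refine (realize_congr χ fun j hj => ?_).1 hy
        rcases j with j | j
        · simp only [Sum.elim_inl]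
          rw [Function.update_of_ne]
          rintro rfl
          exact hi.2 hj
        · simp
    · intro w hw
      exact (Formula.realize_inf.1 hw).1
    · intro w hw _ _
      exact (hr w).1 (Formula.realize_inf.1 hw).2
  · push Not at h
    exact ⟨θ, hθ, fun _ h => h, 0, fun w hw y hy => absurd hy (h w hw y)⟩

theorem omitting [Countable L.Symbols] [Nonempty M] {n : ℕ} {a : Fin n → M}
    (ha : ¬ (∅ : Set M).Definable L {b : Fin n → M | SameType L a b}) :
    ∃ (v : ℕ → ℕ → M),
      (∀ χ : L.Formula (ℕ ⊕ Fin 1), ∃ i, ∀ᶠ k in Filter.atTop, ∀ y : M,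
        χ.Realize (Sum.elim (v k) (fun _ => y)) → χ.Realize (Sum.elim (v k) (fun _ => v k i))) ∧
      (∀ f : Fin n → ℕ, ∃ φ : L.Formula (Fin n), φ.Realize a ∧
        ∀ᶠ k in Filter.atTop, ¬ φ.Realize (v k ∘ f)) := by
  let P := {θ : L.Formula ℕ // ∃ w : ℕ → M, θ.Realize w}
  let _ : Preorder P :=
    { le := fun s t => ∀ w : ℕ → M, t.1.Realize w → s.1.Realize w
      le_refl := fun _ _ h => h
      le_trans := fun _ _ _ h1 h2 w h => h1 w (h2 w h) }
  obtain ⟨_⟩ := nonempty_encodable (L.Formula (ℕ ⊕ Fin 1) ⊕ (Fin n → ℕ))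
  let D : L.Formula (ℕ ⊕ Fin 1) ⊕ (Fin n → ℕ) → Order.Cofinal P := Sum.elim
    (fun χ => ⟨{θ | ∃ i, ∀ w : ℕ → M, θ.1.Realize w → ∀ y : M,
        χ.Realize (Sum.elim w (fun _ => y)) → χ.Realize (Sum.elim w (fun _ => w i))}, fun θ => by
      obtain ⟨t, h1, h2, h3⟩ := henkin_density θ.1 θ.2 χ
      exact ⟨⟨t, h1⟩, h3, h2⟩⟩)
    (fun f => ⟨{θ | ∃ φ : L.Formula (Fin n), φ.Realize a ∧
        ∀ w : ℕ → M, θ.1.Realize w → ¬ φ.Realize (w ∘ f)}, fun θ => by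
      obtain ⟨φ, h1, w, h2, h3⟩ := avoid_density ha θ.1 θ.2 f
      have hr : ∀ w : ℕ → M, (θ.1 ⊓ (φ.relabel f).not).Realize w ↔
          θ.1.Realize w ∧ ¬ φ.Realize (w ∘ f) := fun w => by
        rw [Formula.realize_inf, Formula.realize_not, Formula.realize_relabel]
      exact ⟨⟨θ.1 ⊓ (φ.relabel f).not, w, (hr w).2 ⟨h2, h3⟩⟩,
        ⟨φ, h1, fun w hw => ((hr w).1 hw).2⟩, fun w hw => ((hr w).1 hw).1⟩⟩)
  let p0 : P := ⟨⊤, fun _ => Classical.arbitrary M, by simp⟩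
  let q := Order.sequenceOfCofinals p0 D
  have hq : Monotone q := Order.sequenceOfCofinals.monotone p0 D
  choose v hv using fun k => (q k).2
  refine ⟨v, fun χ => ?_, fun f => ?_⟩
  · obtain ⟨i, hi⟩ := Order.sequenceOfCofinals.encode_mem p0 D (Sum.inl χ)
    refine ⟨i, Filter.eventually_atTop.2 ⟨_, fun k hk => hi (v k) (hq hk _ (hv k))⟩⟩
  · obtain ⟨φ, h1, h2⟩ := Order.sequenceOfCofinals.encode_mem p0 D (Sum.inr f)
    refine ⟨φ, h1, Filter.eventually_atTop.2 ⟨_, fun k hk => h2 (v k) (hq hk _ (hv k))⟩⟩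

theorem omitting_model.{u, v, w} {L : FirstOrder.Language.{u, v}} {M : Type w} [L.Structure M]
    [Countable L.Symbols] [Nonempty M] {n : ℕ} {a : Fin n → M}
    (ha : ¬ (∅ : Set M).Definable L {b : Fin n → M | SameType L a b}) :
    ∃ (N : CategoryTheory.Bundled.{w} L.Structure), Countable N ∧ (M ≅[L] N) ∧
      ∀ b : Fin n → N, ∃ φ : L.Formula (Fin n), φ.Realize a ∧ ¬ φ.Realize b := by
  obtain ⟨v, hv1, hv2⟩ := omitting ha
  let u : Ultrafilter ℕ := Filter.hyperfilter ℕ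
  have hu : (u : Filter ℕ) ≤ Filter.atTop := by
    rw [← Nat.cofinite_eq_atTop]; exact Filter.hyperfilter_le_cofinite
  let U : Type w := (u : Filter ℕ).Product (fun _ : ℕ => M)
  let c : (ℕ → M) → U := fun x => (x : (u : Filter ℕ).Product (fun _ : ℕ => M))
  have hc : Function.Surjective c := Quotient.mk_surjective
  have los : ∀ {β : Type} (φ : L.Formula β) (x : β → ℕ → M),
      φ.Realize (fun i => c (x i)) ↔ ∀ᶠ k in (u : Filter ℕ), φ.Realize (fun i => x i k) :=
    fun φ x => Ultraproduct.realize_formula_cast φ x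
  have hMU : M ≅[L] U := by
    rw [elementarilyEquivalent_iff]
    intro φ
    have := Ultraproduct.sentence_realize (u := u) (M := fun _ : ℕ => M) φ
    rw [this]; simp
  let z : ℕ → U := fun i => c (fun k => v k i)
  have hmeet : L.MeetsDefinable (Set.range z) := by
    rintro E ⟨e, he⟩ hE
    obtain ⟨φ, hφ⟩ := Set.definable_iff_exists_formula_sum.1 hE
    have hidx : ∀ x : Set.range z, ∃ i, z i = x := fun x => x.2
    choose g hg using hidx
    let χ : L.Formula (ℕ ⊕ Fin 1) := φ.relabel (Sum.map g id)
    have hχ : ∀ y : U, χ.Realize (Sum.elim z (fun _ => y)) ↔ y ∈ E := by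
      intro y
      have h1 : y ∈ E ↔ (fun _ : Fin 1 => y) ∈ {x : Fin 1 → U | x 0 ∈ E} := Iff.rfl
      rw [h1, hφ, Formula.realize_relabel]
      have : (Sum.elim z (fun _ : Fin 1 => y)) ∘ Sum.map g id =
          Sum.elim (fun x : Set.range z => (x : U)) (fun _ : Fin 1 => y) := by
        ext j; rcases j with j | j
        · exact hg j
        · rfl
      rw [this]; rfl
    have hχ' : ∀ y : ℕ → M, c y ∈ E ↔
        ∀ᶠ k in (u : Filter ℕ), χ.Realize (Sum.elim (v k) (fun _ => y k)) := by
      intro y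
      rw [← hχ]
      have := los χ (Sum.elim (fun i k => v k i) (fun _ => y))
      have e1 : (fun i => c ((Sum.elim (fun i k => v k i) (fun _ : Fin 1 => y) :
          ℕ ⊕ Fin 1 → ℕ → M) i)) = Sum.elim z (fun _ => c y) := by
        ext j; cases j <;> rfl
      have e2 : ∀ k, (fun i => (Sum.elim (fun i k => v k i) (fun _ : Fin 1 => y) :
          ℕ ⊕ Fin 1 → ℕ → M) i k) = Sum.elim (v k) (fun _ => y k) := by
        intro k; ext j; cases j <;> rfl
      simp only [e1, e2] at this
      exact this
    obtain ⟨y, rfl⟩ := hc e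
    obtain ⟨i, hi⟩ := hv1 χ
    refine ⟨z i, (hχ' _).2 ?_, i, rfl⟩
    filter_upwards [(hχ' y).1 he, hu hi] with k hk1 hk2
    exact hk2 _ hk1
  let S := hmeet.toElementarySubstructure
  have hS : ∀ x : S, ∃ i, z i = (x : U) := fun x => by
    have h1 : (x : U) ∈ (Substructure.closure L (Set.range z) : Set U) := x.2
    rw [hmeet.closure_eq_self] at h1
    exact h1
  refine ⟨⟨(S : Type w), inferInstance⟩, ?_, ?_, ?_⟩
  · choose g hg using hS
    exact Function.Injective.countable (f := g) fun x y h => by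
      apply Subtype.ext
      rw [← hg x, ← hg y, h]
  · exact hMU.trans S.subtype.elementarilyEquivalent.symm
  · intro b
    choose f hf using fun i => hS (b i)
    obtain ⟨φ, h1, h2⟩ := hv2 f
    refine ⟨φ, h1, fun h3 => ?_⟩
    have h4 : φ.Realize (fun i => c (fun k => v k (f i))) := by
      have := (S.subtype.map_formula φ b).2 h3
      convert this using 1
      ext i
      exact hf i
    obtain ⟨k, hk1, hk2⟩ := (((los φ _).1 h4).and (hu h2)).exists
    exact hk2 hk1

end RN

theorem stmt_2 (L : FirstOrder.Language) [Countable L.Symbols]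
    (M : Type*) [L.Structure M] [Countable M] [Infinite M]
    (hcat : Cardinal.Categorical ℵ₀ (L.completeTheory M)) (n : ℕ) (a : Fin n → M) :
    Set.Definable (∅ : Set M) L {b : Fin n → M | ∃ π : M ≃[L] M, ⇑π ∘ a = b} := by
  have hiso : ∀ (n : ℕ) (a : Fin n → M),
      (∅ : Set M).Definable L {b : Fin n → M | RN.SameType L a b} := by
    intro n a
    by_contra ha
    obtain ⟨N, hNc, hMN, hNtype⟩ := RN.omitting_model ha
    have hNi : Infinite N := hMN.infinite_iff.1 inferInstance
    have hNe : Nonempty N := inferInstance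
    have hMm : M ⊨ L.completeTheory M := inferInstance
    have hNm : N ⊨ L.completeTheory M := hMN.theory_model
    obtain ⟨eM⟩ : Nonempty (M ≃ ULift ℕ) := by
      obtain ⟨_⟩ := nonempty_denumerable M
      exact ⟨(Denumerable.eqv M).trans Equiv.ulift.symm⟩
    obtain ⟨eN⟩ : Nonempty (N ≃ ULift ℕ) := by
      obtain ⟨_⟩ := nonempty_denumerable N
      exact ⟨(Denumerable.eqv N).trans Equiv.ulift.symm⟩
    let M' := Language.Theory.ModelType.equivInduced (M := Language.Theory.ModelType.of (L.completeTheory M) M) eM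
    let N' := Language.Theory.ModelType.equivInduced (M := Language.Theory.ModelType.of (L.completeTheory M) N) eN
    obtain ⟨g⟩ := hcat M' N' (show #(ULift ℕ) = ℵ₀ by simp) (show #(ULift ℕ) = ℵ₀ by simp)
    let g1 : M ≃[L] M' := eM.inducedStructureEquiv
    let g2 : N ≃[L] N' := eN.inducedStructureEquiv
    let h : M ≃[L] N := g2.symm.comp (g.comp g1)
    obtain ⟨φ, h1, h2⟩ := hNtype (h ∘ a)
    exact h2 ((Language.StrongHomClass.realize_formula h φ).2 h1)
  convert hiso n a using 1
  ext b
  constructor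
  · rintro ⟨π, rfl⟩ φ
    exact (Language.StrongHomClass.realize_formula π φ).symm
  · exact fun h => RN.back_forth hiso h
end

section
/- Let L be a countable first-order language and M a countably infinite L-structure whose complete theory is ℵ₀-categorical. Then two tuples a, b : Fin n → M lie in the same orbit of the coordinatewise action of the automorphism group of M if and only if they satisfy exactly the same first-order L-formulas with n free variables in M. -/
open FirstOrder Cardinal

namespace RN

open FirstOrder.Language

universe u v w w'

/-- Homogeneity for finite tuples. -/
def Homog (L : FirstOrder.Language.{u, v}) (N : Type w) [L.Structure N] : Prop :=
  ∀ (n : ℕ) (a b : Fin n → N), (∀ φ : L.Formula (Fin n), φ.Realize a ↔ φ.Realize b) →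
    ∀ c : N, ∃ d : N, ∀ φ : L.Formula (Fin n ⊕ Unit),
      φ.Realize (Sum.elim a fun _ => c) ↔ φ.Realize (Sum.elim b fun _ => d)

/-- The ultrapower along a nonprincipal ultrafilter. -/
abbrev UP (M : Type w) : Type w := ((Filter.hyperfilter ℕ : Ultrafilter ℕ) : Filter ℕ).Product
  (fun _ : ℕ => M)

theorem homog_ultrapower (L : FirstOrder.Language.{u, v}) [Countable L.Symbols]
    (M : Type w) [L.Structure M] [Nonempty M] : Homog L (UP M) := by
  intro n a b hab c
  have hcount : Countable (L.Formula (Fin n ⊕ Unit)) := by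
    have : Countable (Σ l, L.Functions l) :=
      (Sum.inl_injective (α := Σ l, L.Functions l) (β := Σ l, L.Relations l)).countable
    have : Countable (Σ l, L.Relations l) :=
      (Sum.inr_injective (α := Σ l, L.Functions l) (β := Σ l, L.Relations l)).countable
    infer_instance
  obtain ⟨e, he⟩ := exists_surjective_nat (L.Formula (Fin n ⊕ Unit))
  classical
  have hq : ∀ x : UP M, ∃ y : ℕ → M, (Quotient.mk _ y : UP M) = x := fun x => Quotient.exists_rep x
  choose rep hrep using hq
  let b' : Fin n → ℕ → M := fun i => rep (b i)
  let p : L.Formula (Fin n ⊕ Unit) → Prop := fun φ => φ.Realize (Sum.elim a fun _ => c)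
  let χ : ℕ → L.Formula (Fin n ⊕ Unit) := fun k =>
    BoundedFormula.iInf (fun i : Fin k => if p (e i) then e i else ⊤)
  have hχ : ∀ {X : Type w} [L.Structure X] (k : ℕ) (v : Fin n ⊕ Unit → X),
      (χ k).Realize v ↔ ∀ i < k, p (e i) → (e i).Realize v := by
    intro X _ k v
    simp only [χ, Formula.Realize, BoundedFormula.realize_iInf]
    constructor
    · intro h i hi hp
      have := h ⟨i, hi⟩
      simpa [hp] using this
    · intro h i
      by_cases hp : p (e i)
      · simpa [hp] using h i i.2 hp
      · simp [hp]
  let A : ℕ → ℕ → Prop := fun k j => ∃ x : M, (χ k).Realize (Sum.elim (fun i => b' i j) fun _ => x)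
  have hA : ∀ k, ∀ᶠ j in (Filter.hyperfilter ℕ : Filter ℕ), A k j := by
    intro k
    have h1 : ((χ k).iExs Unit).Realize a := by
      rw [Formula.realize_iExs]
      exact ⟨fun _ => c, (hχ k _).2 fun i _ h => h⟩
    rw [hab] at h1
    have hb : b = fun i => (Quotient.mk _ (b' i) : UP M) := by
      funext i; exact (hrep _).symm
    rw [hb] at h1
    have h2 := (Ultraproduct.realize_formula_cast (M := fun _ : ℕ => M)
      (u := Filter.hyperfilter ℕ) ((χ k).iExs Unit) b').1 h1
    filter_upwards [h2] with j hj
    rw [Formula.realize_iExs] at hj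
    obtain ⟨i, hi⟩ := hj
    exact ⟨i (), hi⟩
  let K : ℕ → ℕ := fun j => Nat.findGreatest (fun k => A k j) j
  let d' : ℕ → M := fun j => Classical.epsilon fun x =>
    (χ (K j)).Realize (Sum.elim (fun i => b' i j) fun _ => x)
  have key : ∀ φ, p φ → φ.Realize (Sum.elim b fun _ => (Quotient.mk _ d' : UP M)) := by
    intro φ hφ
    obtain ⟨i, rfl⟩ := he φ
    have hv : (Sum.elim b fun _ : Unit => (Quotient.mk _ d' : UP M)) =
        fun s => (Quotient.mk _ ((Sum.elim b' fun _ : Unit => d') s) : UP M) := by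
      funext s
      rcases s with s | s
      · exact (hrep _).symm
      · rfl
    rw [hv]
    refine (Ultraproduct.realize_formula_cast (M := fun _ : ℕ => M)
      (u := Filter.hyperfilter ℕ) (e i) (Sum.elim b' fun _ => d')).2 ?_
    have hge : ∀ᶠ j in (Filter.hyperfilter ℕ : Filter ℕ), i + 1 ≤ j := by
      have : ∀ᶠ j in (Filter.atTop : Filter ℕ), i + 1 ≤ j := Filter.eventually_ge_atTop _
      exact Nat.hyperfilter_le_atTop this
    filter_upwards [hA (i + 1), hge] with j hj hij
    have hK : A (K j) j := Nat.findGreatest_spec (P := fun k => A k j) hij hj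
    have hKi : i + 1 ≤ K j := Nat.le_findGreatest hij hj
    have hd := (hχ (K j) _).1 (Classical.epsilon_spec hK) i (by omega) hφ
    convert hd using 1
    funext s
    rcases s with s | s <;> rfl
  refine ⟨Quotient.mk _ d', fun φ => ⟨key φ, fun h => ?_⟩⟩
  by_contra hn
  exact (Formula.realize_not.1 (key φ.not (Formula.realize_not.2 hn))) h

/-- Language of homogeneity witness functions. -/
def Lw : FirstOrder.Language.{0, 0} where
  Functions k := Σ n : ℕ, (Fin n → Fin k) × (Fin n → Fin k) × Fin k
  Relations _ := Empty

theorem exists_countable_homog (L : FirstOrder.Language.{u, v}) [Countable L.Symbols]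
    (N : Type w) [L.Structure N] [Infinite N] (hN : Homog L N) :
    ∃ (S : Type w) (_ : L.Structure S), #S = ℵ₀ ∧ S ⊨ L.completeTheory N ∧ Homog L S := by
  classical
  have hN' : ∀ (n : ℕ) (a b : Fin n → N) (c : N), ∃ d : N,
      (∀ φ : L.Formula (Fin n), φ.Realize a ↔ φ.Realize b) → ∀ φ : L.Formula (Fin n ⊕ Unit),
      φ.Realize (Sum.elim a fun _ => c) ↔ φ.Realize (Sum.elim b fun _ => d) := by
    intro n a b c
    by_cases h : ∀ φ : L.Formula (Fin n), φ.Realize a ↔ φ.Realize b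
    · obtain ⟨d, hd⟩ := hN n a b h c
      exact ⟨d, fun _ => hd⟩
    · exact ⟨c, fun h' => absurd h' h⟩
  choose W hW using hN'
  letI : Lw.Structure N :=
    { funMap := fun {k} f x => W f.1 (x ∘ f.2.1) (x ∘ f.2.2.1) (x f.2.2.2)
      RelMap := fun r _ => r.elim }
  have hc : Countable (L.sum Lw).Symbols := by
    have : Countable (Σ l, L.Functions l) :=
      (Sum.inl_injective (α := Σ l, L.Functions l) (β := Σ l, L.Relations l)).countable
    have : Countable (Σ l, L.Relations l) :=
      (Sum.inr_injective (α := Σ l, L.Functions l) (β := Σ l, L.Relations l)).countable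
    have h1 : ∀ l, Countable (L.Functions l) := fun l =>
      (sigma_mk_injective (i := l) (β := L.Functions)).countable
    have h2 : ∀ l, Countable (L.Relations l) := fun l =>
      (sigma_mk_injective (i := l) (β := L.Relations)).countable
    have h3 : ∀ l, Countable (Lw.Functions l) := fun l => by unfold Lw; infer_instance
    have h4 : ∀ l, Countable (Lw.Relations l) := fun l => by unfold Lw; infer_instance
    have h5 : ∀ l, Countable ((L.sum Lw).Functions l) := fun l =>
      inferInstanceAs (Countable (L.Functions l ⊕ Lw.Functions l))
    have h6 : ∀ l, Countable ((L.sum Lw).Relations l) := fun l =>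
      inferInstanceAs (Countable (L.Relations l ⊕ Lw.Relations l))
    unfold Language.Symbols
    infer_instance
  obtain ⟨S, -, hS⟩ := exists_elementarySubstructure_card_eq (L.sum Lw) (M := N) ∅ (ℵ₀ : Cardinal.{w})
    le_rfl (by simp) (by
      have : (L.sum Lw).card ≤ ℵ₀ := Cardinal.mk_le_aleph0_iff.2 hc
      simpa using this) (by simp)
  letI : L.Structure S := (LHom.sumInl : L →ᴸ L.sum Lw).reduct S
  have hel : ∀ {α : Type} (φ : L.Formula α) (x : α → S),
      φ.Realize (fun i => (x i : N)) ↔ φ.Realize x := by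
    intro α φ x
    have h := S.subtype.map_formula ((LHom.sumInl : L →ᴸ L.sum Lw).onFormula φ) x
    rw [LHom.realize_onFormula, LHom.realize_onFormula] at h
    exact h
  refine ⟨S, inferInstance, by simpa using hS, ?_, ?_⟩
  · refine Theory.model_iff _ |>.2 fun φ hφ => ?_
    have h1 : N ⊨ φ := hφ
    have := hel φ default
    refine Eq.mp ?_ (this.1 ?_)
    · rfl
    · unfold Sentence.Realize at h1
      convert h1
  · intro n a b hab c
    let e : (Fin n ⊕ Fin n ⊕ Unit) ≃ Fin (Fintype.card (Fin n ⊕ Fin n ⊕ Unit)) :=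
      Fintype.equivFin _
    let x : Fin (Fintype.card (Fin n ⊕ Fin n ⊕ Unit)) → S :=
      (Sum.elim a (Sum.elim b fun _ => c)) ∘ e.symm
    let f : (L.sum Lw).Functions (Fintype.card (Fin n ⊕ Fin n ⊕ Unit)) :=
      Sum.inr ⟨n, fun i => e (Sum.inl i), fun i => e (Sum.inr (Sum.inl i)),
        e (Sum.inr (Sum.inr ()))⟩
    have hf : ((Structure.funMap f x : S) : N) =
        W n (fun i => (a i : N)) (fun i => (b i : N)) (c : N) := by
      have h1 := S.subtype.map_fun f x
      refine Eq.trans h1 ?_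
      change W n _ _ _ = _
      congr 1 <;> simp [x, Function.comp_def]
    refine ⟨Structure.funMap f x, fun φ => ?_⟩
    rw [← hel, ← hel]
    have h2 := hW n (fun i => (a i : N)) (fun i => (b i : N)) (c : N)
      (fun φ => by rw [hel, hel]; exact hab φ) φ
    rw [← hf] at h2
    convert h2 using 2 <;> (funext s; rcases s with s | s <;> rfl)

theorem homog_of_equiv (L : FirstOrder.Language.{u, v}) {N : Type w} {M : Type w'} [L.Structure N]
    [L.Structure M] (g : M ≃[L] N) (hN : Homog L N) : Homog L M := by
  intro n a b hab c
  obtain ⟨d, hd⟩ := hN n (g ∘ a) (g ∘ b) (fun φ => by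
    rw [StrongHomClass.realize_formula, StrongHomClass.realize_formula]; exact hab φ) (g c)
  refine ⟨g.symm d, fun φ => ?_⟩
  rw [← StrongHomClass.realize_formula g, ← StrongHomClass.realize_formula g (v := Sum.elim b _)]
  convert hd φ using 2 <;> (funext s; rcases s with s | s <;> simp)

/-- A relation is elementary. -/
def IsElem (L : FirstOrder.Language.{u, v}) {M : Type w} [L.Structure M] (R : Set (M × M)) : Prop :=
  ∀ (n : ℕ) (x : Fin n → M × M), (∀ i, x i ∈ R) → ∀ φ : L.Formula (Fin n),
    φ.Realize (fun i => (x i).1) ↔ φ.Realize (fun i => (x i).2)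

theorem IsElem.swap {L : FirstOrder.Language.{u, v}} {M : Type w} [L.Structure M]
    {R : Set (M × M)} (h : IsElem L R) : IsElem L (Prod.swap ⁻¹' R) :=
  fun n x hx φ => (h n (fun i => (x i).swap) hx φ).symm

theorem IsElem.extend {L : FirstOrder.Language.{u, v}} {M : Type w} [L.Structure M]
    (hM : Homog L M) {R : Set (M × M)} (hR : R.Finite) (h : IsElem L R) (c : M) :
    ∃ d, IsElem L (insert (c, d) R) := by
  classical
  obtain ⟨n, x, -, hx⟩ := hR.fin_param
  obtain ⟨d, hd⟩ := hM n (fun i => (x i).1) (fun i => (x i).2)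
    (h n x fun i => hx ▸ Set.mem_range_self i) c
  refine ⟨d, fun m y hy φ => ?_⟩
  have : ∀ i, ∃ s : Fin n ⊕ Unit, Sum.elim x (fun _ => (c, d)) s = y i := by
    intro i
    rcases hy i with h1 | h1
    · exact ⟨Sum.inr (), h1.symm⟩
    · rw [← hx] at h1
      obtain ⟨j, hj⟩ := h1
      exact ⟨Sum.inl j, hj⟩
  choose g hg using this
  have h3 := hd (φ.relabel g)
  rw [Formula.realize_relabel, Formula.realize_relabel] at h3
  convert h3 using 2 <;>
  · funext i
    simp only [Function.comp_apply]
    rw [← hg i]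
    rcases hgi : g i with s | s <;> simp [hgi]

theorem IsElem.extend' {L : FirstOrder.Language.{u, v}} {M : Type w} [L.Structure M]
    (hM : Homog L M) {R : Set (M × M)} (hR : R.Finite) (h : IsElem L R) (d : M) :
    ∃ c, IsElem L (insert (c, d) R) := by
  obtain ⟨c, hc⟩ := IsElem.extend hM (hR.preimage Prod.swap_injective.injOn) h.swap d
  refine ⟨c, ?_⟩
  have := hc.swap
  convert this using 1
  ext ⟨p, q⟩
  simp [and_comm]

theorem exists_aut {L : FirstOrder.Language.{u, v}} {M : Type w} [L.Structure M] [Countable M]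
    (hM : Homog L M) {n : ℕ} {a b : Fin n → M}
    (hab : ∀ φ : L.Formula (Fin n), φ.Realize a ↔ φ.Realize b) :
    ∃ π : M ≃[L] M, ⇑π ∘ a = b := by
  classical
  let P := {R : Set (M × M) // R.Finite ∧ IsElem L R}
  let p0 : P := ⟨Set.range fun i => (a i, b i), Set.finite_range _, by
    intro m x hx φ
    choose g hg using hx
    have h3 := hab (φ.relabel g)
    rw [Formula.realize_relabel, Formula.realize_relabel] at h3
    convert h3 using 2 <;> (funext i; simp only [Function.comp_apply]; rw [← hg i])⟩
  let D : M ⊕ M → Order.Cofinal P := fun s => Sum.elim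
    (fun c => ⟨{R | ∃ d, (c, d) ∈ R.1}, fun R => by
      obtain ⟨d, hd⟩ := R.2.2.extend hM R.2.1 c
      exact ⟨⟨_, R.2.1.insert _, hd⟩, ⟨d, Set.mem_insert _ _⟩, Set.subset_insert _ _⟩⟩)
    (fun d => ⟨{R | ∃ c, (c, d) ∈ R.1}, fun R => by
      obtain ⟨c, hc⟩ := R.2.2.extend' hM R.2.1 d
      exact ⟨⟨_, R.2.1.insert _, hc⟩, ⟨c, Set.mem_insert _ _⟩, Set.subset_insert _ _⟩⟩) s
  haveI : Encodable (M ⊕ M) := Encodable.ofCountable _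
  let I := Order.idealOfCofinals p0 D
  let T : Set (M × M) := {q | ∃ R ∈ I, q ∈ R.1}
  have hT : IsElem L T := by
    intro m x hx
    choose R hR hxR using hx
    have hdir : Directed (· ≤ ·) (Subtype.val : {R : P // R ∈ I} → P) :=
      directedOn_iff_directed.1 I.directed
    have : Nonempty {R : P // R ∈ I} := ⟨⟨p0, Order.mem_idealOfCofinals p0 D⟩⟩
    obtain ⟨z, hz⟩ := hdir.finite_le (fun i : Fin m => (⟨R i, hR i⟩ : {R : P // R ∈ I}))
    exact z.1.2.2 m x fun i => hz i (hxR i)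
  have hdom : ∀ c, ∃ d, (c, d) ∈ T := by
    intro c
    obtain ⟨R, ⟨d, hd⟩, hRI⟩ := Order.cofinal_meets_idealOfCofinals p0 D (Sum.inl c)
    exact ⟨d, R, hRI, hd⟩
  have hcod : ∀ d, ∃ c, (c, d) ∈ T := by
    intro d
    obtain ⟨R, ⟨c, hc⟩, hRI⟩ := Order.cofinal_meets_idealOfCofinals p0 D (Sum.inr d)
    exact ⟨c, R, hRI, hc⟩
  have hfun : ∀ c d d', (c, d) ∈ T → (c, d') ∈ T → d = d' := by
    intro c d d' h h'
    have := (hT 2 ![(c, d), (c, d')] (by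
      intro i; fin_cases i
      · exact h
      · exact h') ((Term.var 0).equal (Term.var 1))).1 (by simp [Formula.realize_equal])
    simpa [Formula.realize_equal] using this
  choose f hf using hdom
  let F : M ↪ₑ[L] M := ⟨f, fun m φ x => (hT m (fun i => (x i, f (x i))) (fun i => hf _) φ).symm⟩
  have hsurj : Function.Surjective F := by
    intro d
    obtain ⟨c, hc⟩ := hcod d
    exact ⟨c, hfun _ _ _ (hf c) hc⟩
  refine ⟨{ Equiv.ofBijective F ⟨F.injective, hsurj⟩ with
    map_fun' := fun g x => F.map_fun g x
    map_rel' := fun r x => F.map_rel r x }, ?_⟩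
  funext i
  exact hfun _ _ _ (hf (a i)) ⟨p0, Order.mem_idealOfCofinals p0 D, ⟨i, rfl⟩⟩

theorem iso_of_cat {L : FirstOrder.Language.{u, v}} {T : L.Theory}
    (hcat : Cardinal.Categorical (ℵ₀ : Cardinal.{w'}) T)
    (M N : Type w) [L.Structure M] [L.Structure N] [M ⊨ T] [N ⊨ T]
    (hM : #M = ℵ₀) (hN : #N = ℵ₀) : Nonempty (M ≃[L] N) := by
  have eM : Nonempty (M ≃ ULift.{w'} ℕ) := by
    rw [← Cardinal.lift_mk_eq']; simp [hM]
  have eN : Nonempty (N ≃ ULift.{w'} ℕ) := by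
    rw [← Cardinal.lift_mk_eq']; simp [hN]
  obtain ⟨eM⟩ := eM
  obtain ⟨eN⟩ := eN
  have : Nonempty M := ⟨eM.symm ⟨0⟩⟩
  have : Nonempty N := ⟨eN.symm ⟨0⟩⟩
  let M' : T.ModelType := Theory.ModelType.equivInduced (M := Theory.ModelType.of T M) eM
  let N' : T.ModelType := Theory.ModelType.equivInduced (M := Theory.ModelType.of T N) eN
  obtain ⟨g⟩ := hcat M' N' (show #(ULift.{w'} ℕ) = _ by simp) (show #(ULift.{w'} ℕ) = _ by simp)
  letI s1 : L.Structure (ULift.{w'} ℕ) := eM.inducedStructure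
  have h1 : M ≃[L] M' := eM.inducedStructureEquiv
  have h2 : N ≃[L] N' :=
    letI s1 : L.Structure (ULift.{w'} ℕ) := eN.inducedStructure
    eN.inducedStructureEquiv
  exact ⟨h2.symm.comp (g.comp h1)⟩

end RN

/-- In a countably infinite structure `M` over a countable language whose complete theory is
ℵ₀-categorical, two `n`-tuples lie in the same orbit of the automorphism group of `M`
if and only if they satisfy the same first-order formulas with `n` free variables. -/
theorem stmt_3 (L : FirstOrder.Language) [Countable L.Symbols]
    (M : Type*) [L.Structure M] [Countable M] [Infinite M]
    (hcat : Cardinal.Categorical ℵ₀ (L.completeTheory M)) (n : ℕ) (a b : Fin n → M) :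
    (∃ π : M ≃[L] M, ⇑π ∘ a = b) ↔
      (∀ φ : L.Formula (Fin n), φ.Realize a ↔ φ.Realize b) := by
  constructor
  · rintro ⟨π, rfl⟩ φ
    exact (FirstOrder.Language.StrongHomClass.realize_formula π φ).symm
  · intro hab
    have hth : L.completeTheory (RN.UP M) = L.completeTheory M := by
      ext φ
      change RN.UP M ⊨ φ ↔ M ⊨ φ
      rw [FirstOrder.Language.Ultraproduct.sentence_realize]
      simp
    have hinf : Infinite (RN.UP M) := by
      refine Infinite.of_injective (fun m : M => (Quotient.mk _ (fun _ => m) : RN.UP M)) ?_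
      intro x y hxy
      have h := Quotient.exact hxy
      have h' : ∀ᶠ _j in (Filter.hyperfilter ℕ : Filter ℕ), x = y := h
      simpa using h'
    obtain ⟨S, sS, hS, hmod, hhom⟩ :=
      RN.exists_countable_homog L (RN.UP M) (RN.homog_ultrapower L M)
    rw [hth] at hmod
    obtain ⟨g⟩ := RN.iso_of_cat hcat M S (Cardinal.mk_eq_aleph0 M) hS
    exact RN.exists_aut (RN.homog_of_equiv L g hhom) hab
end
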